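/- Let n ≥ 1. There exists a constant C > 0 such that ‖φ_ν‖_{L^∞(ℝⁿ)} ≤ C |ν|^{−1/12} for all ν ∈ ℕ₀ⁿ with ν ≠ 0. -/

import Mathlib

open MeasureTheory Filter
open scoped ENNReal

noncomputable section

/-- Physicists' Hermite polynomial `H_k` as a real function:
`H_k(t) = (−1)^k e^{t²} (d/dt)^k e^{−t²}`. -/
def hermitePolyFun (k : ℕ) (t : ℝ) : ℝ :=
  (-1 : ℝ) ^ k * Real.exp (t ^ 2) * iteratedDeriv k (fun s => Real.exp (-s ^ 2)) t

/-- One-dimensional Hermite function `φ_k(t) = (2^k k! √π)^{-1/2} H_k(t) e^{-t²/2}`. -/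
def hermiteFun (k : ℕ) (t : ℝ) : ℝ :=
  ((2 : ℝ) ^ k * (Nat.factorial k : ℝ) * Real.sqrt Real.pi) ^ (-(1 : ℝ) / 2) *
    hermitePolyFun k t * Real.exp (-(t ^ 2) / 2)

/-- Hermite function `φ_ν` on `ℝⁿ`, `φ_ν(x) = ∏ⱼ φ_{νⱼ}(xⱼ)`. -/
def hermiteFunPi {n : ℕ} (ν : Fin n → ℕ) (x : Fin n → ℝ) : ℝ :=
  ∏ j, hermiteFun (ν j) (x j)

/-- Fourier–Hermite coefficient `f̂(φ_ν) = ∫ f(x) φ_ν(x) dx` of a Schwartz function. -/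
def hermiteCoeff {n : ℕ} (f : SchwartzMap (Fin n → ℝ) ℂ) (ν : Fin n → ℕ) : ℂ :=
  ∫ x : Fin n → ℝ, f x * (hermiteFunPi ν x : ℂ)

/-- Pseudo-multiplier associated to the harmonic oscillator:
`T_m f(x) = Σ_ν m(x,ν) f̂(φ_ν) φ_ν(x)`. -/
def pseudoMult {n : ℕ} (m : (Fin n → ℝ) → (Fin n → ℕ) → ℂ)
    (f : SchwartzMap (Fin n → ℝ) ℂ) (x : Fin n → ℝ) : ℂ :=
  ∑' ν : Fin n → ℕ, m x ν * hermiteCoeff f ν * (hermiteFunPi ν x : ℂ)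

/-- Inverse Fourier–Hermite transform `𝓕_H⁻¹ u (x) = Σ_ν u(ν) φ_ν(x)`. -/
def fhInv {n : ℕ} (u : (Fin n → ℕ) → ℂ) (x : Fin n → ℝ) : ℂ :=
  ∑' ν : Fin n → ℕ, u ν * (hermiteFunPi ν x : ℂ)

/-- Euclidean Fourier transform on `ℝⁿ` (modelled as `Fin n → ℝ`). -/
def fourierPi {n : ℕ} (g : (Fin n → ℝ) → ℂ) (x : Fin n → ℝ) : ℂ :=
  ∫ ξ : Fin n → ℝ, Complex.exp (-(2 * Real.pi * (∑ j, x j * ξ j)) * Complex.I) * g ξ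

/-- One-dimensional Fourier transform. -/
def fourier1 (g : ℝ → ℂ) (t : ℝ) : ℂ :=
  ∫ τ : ℝ, Complex.exp (-(2 * Real.pi * (t * τ)) * Complex.I) * g τ

/-- Partial derivative in the `j`-th coordinate. -/
def pderiv1 {n : ℕ} (j : Fin n) (f : (Fin n → ℝ) → ℂ) : (Fin n → ℝ) → ℂ :=
  fun ξ => fderiv ℝ f ξ (Pi.single j 1)

/-- Multi-index partial derivative `∂^α`. -/
def pderivMulti {n : ℕ} (α : Fin n → ℕ) (f : (Fin n → ℝ) → ℂ) : (Fin n → ℝ) → ℂ :=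
  (List.finRange n).foldr (fun j g => (pderiv1 j)^[α j] g) f

/-- Forward difference in the `j`-th coordinate. -/
def dDiff {n : ℕ} (j : Fin n) (g : (Fin n → ℕ) → ℂ) : (Fin n → ℕ) → ℂ :=
  fun ν => g (ν + Pi.single j 1) - g ν

/-- Multi-index forward difference `Δ^α`. -/
def dDiffMulti {n : ℕ} (α : Fin n → ℕ) (g : (Fin n → ℕ) → ℂ) : (Fin n → ℕ) → ℂ :=
  (List.finRange n).foldr (fun j h => (dDiff j)^[α j] h) g

/-- Projection onto the `ℓ`-th Hermite eigenspace: `P_ℓ f = Σ_{|ν|=ℓ} f̂(φ_ν) φ_ν`. -/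
def hermiteProj {n : ℕ} (f : SchwartzMap (Fin n → ℝ) ℂ) (ℓ : ℕ) (x : Fin n → ℝ) : ℂ :=
  ∑' ν : Fin n → ℕ, if (∑ j, ν j) = ℓ then hermiteCoeff f ν * (hermiteFunPi ν x : ℂ) else 0

/-- Spectral pseudo-multiplier `m(x,H) f(x) = Σ_ℓ m(x,ℓ) P_ℓ f(x)`. -/
def spectralPM {n : ℕ} (m : (Fin n → ℝ) → ℝ → ℂ)
    (f : SchwartzMap (Fin n → ℝ) ℂ) (x : Fin n → ℝ) : ℂ :=
  ∑' ℓ : ℕ, m x (ℓ : ℝ) * hermiteProj f ℓ x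

/-- Multilinear pseudo-multiplier. -/
def multiPM {n κ : ℕ} (m : (Fin n → ℝ) → (Fin κ → Fin n → ℕ) → ℂ)
    (f : Fin κ → SchwartzMap (Fin n → ℝ) ℂ) (x : Fin n → ℝ) : ℂ :=
  ∑' ν : Fin κ → Fin n → ℕ,
    m x ν * (∏ j, hermiteCoeff (f j) (ν j)) * ∏ j, (hermiteFunPi (ν j) x : ℂ)

/-- Inverse Fourier–Hermite transform on `ℝ^{nκ}` (modelled as `Fin κ → Fin n → ℝ`). -/
def fhInv2 {n κ : ℕ} (u : (Fin κ → Fin n → ℕ) → ℂ) (z : Fin κ → Fin n → ℝ) : ℂ :=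
  ∑' ν : Fin κ → Fin n → ℕ, u ν * ∏ j, (hermiteFunPi (ν j) (z j) : ℂ)

/-- Euclidean Fourier transform on `ℝ^{nκ}` (modelled as `Fin κ → Fin n → ℝ`). -/
def fourierPi2 {n κ : ℕ} (g : (Fin κ → Fin n → ℝ) → ℂ) (z : Fin κ → Fin n → ℝ) : ℂ :=
  ∫ ξ : Fin κ → Fin n → ℝ,
    Complex.exp (-(2 * Real.pi * (∑ j, ∑ i, z j i * ξ j i)) * Complex.I) * g ξ

open Polynomial in
/-- The physicists' Hermite polynomials, defined by `H₀ = 1`, `H_{k+1} = 2 X H_k - H_k'`. -/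
def physHermite : ℕ → ℝ[X]
  | 0 => 1
  | k + 1 => 2 * X * physHermite k - derivative (physHermite k)

namespace physHermite

open Polynomial

lemma derivative_succ (k : ℕ) :
    derivative (physHermite (k + 1)) = (2 * (k + 1) : ℝ[X]) * physHermite k := by
  induction k with
  | zero => simp [physHermite]
  | succ k ih =>
    have h2 : derivative (derivative (physHermite (k + 1)))
        = (2 * (k + 1) : ℝ[X]) * derivative (physHermite k) := by
      rw [ih]; simp
    have h3 : physHermite (k + 1) = 2 * X * physHermite k - derivative (physHermite k) := rfl
    rw [show physHermite (k + 1 + 1)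
      = 2 * X * physHermite (k + 1) - derivative (physHermite (k + 1)) from rfl, derivative_sub, h2,
      derivative_mul, ih]
    simp only [derivative_mul, derivative_X, derivative_ofNat]
    rw [h3]
    push_cast
    ring

lemma derivative_derivative (k : ℕ) :
    derivative (derivative (physHermite k))
      = 2 * X * derivative (physHermite k) - (2 * k : ℝ[X]) * physHermite k := by
  have h := derivative_succ k
  rw [show physHermite (k + 1) = 2 * X * physHermite k - derivative (physHermite k) from rfl] at h
  simp only [derivative_mul, derivative_X, derivative_ofNat, derivative_sub] at h
  linear_combination -h

lemma eval_succ_succ (k : ℕ) (x : ℝ) :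
    (physHermite (k + 2)).eval x
      = 2 * x * (physHermite (k + 1)).eval x - 2 * (k + 1) * (physHermite k).eval x := by
  rw [show physHermite (k + 2)
    = 2 * X * physHermite (k + 1) - derivative (physHermite (k + 1)) from rfl, derivative_succ]
  simp

lemma eval_neg (k : ℕ) (x : ℝ) :
    (physHermite k).eval (-x) = (-1) ^ k * (physHermite k).eval x := by
  induction k using Nat.twoStepInduction with
  | zero => simp [physHermite]
  | one => simp [physHermite]
  | more k h0 h1 =>
    rw [eval_succ_succ, eval_succ_succ, h0, h1]
    ring

lemma iteratedDeriv_gaussian (k : ℕ) (t : ℝ) :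
    iteratedDeriv k (fun s : ℝ => Real.exp (-s ^ 2)) t
      = (-1) ^ k * (physHermite k).eval t * Real.exp (-t ^ 2) := by
  induction k generalizing t with
  | zero => simp [physHermite]
  | succ k ih =>
    rw [iteratedDeriv_succ, funext ih]
    have h1 : HasDerivAt (fun s : ℝ => Real.exp (-s ^ 2)) (Real.exp (-t ^ 2) * (-(2 * t))) t := by
      have := ((hasDerivAt_pow 2 t).fun_neg).exp
      simpa using this
    have h2 := (((physHermite k).hasDerivAt t).const_mul ((-1 : ℝ) ^ k)).mul h1
    have h3 := h2.deriv
    simp only [Pi.mul_def] at h3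
    rw [h3]
    simp only [physHermite, eval_sub, eval_mul, eval_X, eval_ofNat]
    ring

/-- The square of the normalized value at the origin, `H_k(0)² / (2^k k!)`, is at most
`(k + 1)^{-1/2}`. -/
lemma eval_zero_sq_le (k : ℕ) :
    ((physHermite k).eval 0 ^ 2 / (2 ^ k * (k.factorial : ℝ))) ^ 2 * (k + 1) ≤ 1 := by
  induction k using Nat.twoStepInduction with
  | zero => simp [physHermite]
  | one => simp [physHermite]
  | more k h0 _ =>
    have hb : (physHermite (k + 2)).eval 0 ^ 2 / (2 ^ (k + 2) * ((k + 2).factorial : ℝ))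
        = (k + 1) / (k + 2) * ((physHermite k).eval 0 ^ 2 / (2 ^ k * (k.factorial : ℝ))) := by
      rw [eval_succ_succ, Nat.factorial_succ, Nat.factorial_succ]
      have : (k.factorial : ℝ) ≠ 0 := by positivity
      push_cast
      field_simp
      ring
    rw [hb]
    set b := (physHermite k).eval 0 ^ 2 / (2 ^ k * (k.factorial : ℝ))
    push_cast
    have hk : ((k + 1 : ℝ) / (k + 2)) ^ 2 * (k + 2 + 1) ≤ k + 1 := by
      rw [div_pow, div_mul_eq_mul_div, div_le_iff₀ (by positivity)]
      nlinarith [k.cast_nonneg (α := ℝ)]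
    calc _ = b ^ 2 * (((k + 1 : ℝ) / (k + 2)) ^ 2 * (k + 2 + 1)) := by ring
      _ ≤ b ^ 2 * (k + 1) := by gcongr
      _ ≤ 1 := h0

end physHermite

/-- For a solution of `f'' = -(l - x²) f`, the Liouville–Green energy
`(l - x²)^{1/2} f² + (l - x²)^{-1/2} f'²` is controlled by its value at `0` as long as
`0 ≤ x ≤ (l - l^{1/3})^{1/2}`. -/
lemma oscillator_energy_bound {f f' : ℝ → ℝ} {l s x K : ℝ}
    (hf : ∀ x, HasDerivAt f (f' x) x) (hf' : ∀ x, HasDerivAt f' (-(l - x ^ 2) * f x) x)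
    (hs : 0 < s) (hl : l = s ^ 6)
    (h0 : s ^ 3 * f 0 ^ 2 + f' 0 ^ 2 / s ^ 3 ≤ K)
    (hx0 : 0 ≤ x) (hx : x ^ 2 ≤ s ^ 6 - s ^ 2) :
    √(l - x ^ 2) * f x ^ 2 + f' x ^ 2 / √(l - x ^ 2) ≤ 2 * Real.exp 1 * K := by
  have hpos : ∀ y ∈ Set.Icc 0 x, s ^ 2 ≤ l - y ^ 2 := by
    intro y hy
    have : y ^ 2 ≤ x ^ 2 := pow_le_pow_left₀ hy.1 hy.2 2
    rw [hl]; linarith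
  have hr : ∀ y ∈ Set.Icc 0 x, s ≤ √(l - y ^ 2) := fun y hy =>
    Real.le_sqrt_of_sq_le (hpos y hy)
  have hrsq : ∀ y ∈ Set.Icc 0 x, √(l - y ^ 2) ^ 2 = l - y ^ 2 := fun y hy =>
    Real.sq_sqrt ((sq_nonneg s).trans (hpos y hy))
  have hxs : ∀ y ∈ Set.Icc 0 x, y ≤ √(l - y ^ 2) ^ 3 := by
    intro y hy
    have h1 : y ≤ s ^ 3 := by
      refine le_of_sq_le_sq ?_ (by positivity)
      have := hpos y hy
      rw [hl] at this
      nlinarith [sq_nonneg s]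
    exact h1.trans (pow_le_pow_left₀ hs.le (hr y hy) 3)
  have hr' : ∀ y ∈ Set.Icc 0 x,
      HasDerivAt (fun y => √(l - y ^ 2)) (-y / √(l - y ^ 2)) y := by
    intro y hy
    have h1 : HasDerivAt (fun y : ℝ => l - y ^ 2) (-(2 * y)) y := by
      simpa using (hasDerivAt_pow 2 y).const_sub l
    have hne : l - y ^ 2 ≠ 0 := (lt_of_lt_of_le (by positivity) (hpos y hy)).ne'
    refine HasDerivAt.congr_deriv (h1.sqrt hne) ?_
    have := hs.trans_le (hr y hy)
    field_simp
  set W : ℝ → ℝ := fun y => √(l - y ^ 2) * f y ^ 2 + f' y ^ 2 / √(l - y ^ 2)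
    - y / √(l - y ^ 2) ^ 3 * (f y * f' y) with hW
  have hWge : ∀ y ∈ Set.Icc 0 x, √(l - y ^ 2) * f y ^ 2 + f' y ^ 2 / √(l - y ^ 2) ≤ 2 * W y ∧
      |f y * f' y| ≤ W y := by
    intro y hy
    have hrp := hs.trans_le (hr y hy)
    have ha1 : y / √(l - y ^ 2) ^ 3 ≤ 1 := (div_le_one (by positivity)).2 (hxs y hy)
    have ha0 : 0 ≤ y / √(l - y ^ 2) ^ 3 := div_nonneg hy.1 (by positivity)
    simp only [hW]
    set r := √(l - y ^ 2)
    set a := y / r ^ 3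
    have hAM : 2 * |f y * f' y| ≤ r * f y ^ 2 + f' y ^ 2 / r := by
      rw [abs_mul, ← sq_abs (f y), ← sq_abs (f' y)]
      have : r * |f y| ^ 2 + |f' y| ^ 2 / r - 2 * (|f y| * |f' y|)
          = (r * |f y| - |f' y|) ^ 2 / r := by
        field_simp
        ring
      have : 0 ≤ (r * |f y| - |f' y|) ^ 2 / r := by positivity
      linarith
    have hau : a * (f y * f' y) ≤ |f y * f' y| := by
      calc a * (f y * f' y) ≤ a * |f y * f' y| := by gcongr; exact le_abs_self _
        _ ≤ 1 * |f y * f' y| := by gcongr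
        _ = _ := one_mul _
    constructor <;> linarith
  have ha' : ∀ y ∈ Set.Icc 0 x, HasDerivAt (fun y => y / √(l - y ^ 2) ^ 3)
      (1 / √(l - y ^ 2) ^ 3 + 3 * y ^ 2 / √(l - y ^ 2) ^ 5) y := by
    intro y hy
    have hrp := hs.trans_le (hr y hy)
    refine HasDerivAt.congr_deriv
      ((hasDerivAt_id y).fun_div ((hr' y hy).fun_pow 3) (by positivity)) ?_
    simp only [id]
    field_simp
    ring
  have hW' : ∀ y ∈ Set.Icc 0 x, HasDerivAt W
      (-(1 / √(l - y ^ 2) ^ 3 + 3 * y ^ 2 / √(l - y ^ 2) ^ 5) * (f y * f' y)) y := by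
    intro y hy
    have hrp := hs.trans_le (hr y hy)
    refine HasDerivAt.congr_deriv ((((hr' y hy).fun_mul ((hf y).fun_pow 2)).fun_add
      (((hf' y).fun_pow 2).fun_div (hr' y hy) hrp.ne')).fun_sub
      ((ha' y hy).fun_mul ((hf y).fun_mul (hf' y)))) ?_
    have hq := (hrsq y hy).symm
    generalize √(l - y ^ 2) = r at hq hrp ⊢
    rw [hq]
    field_simp
    ring
  have hanti : AntitoneOn (fun y => W y * Real.exp (-(y / √(l - y ^ 2) ^ 3))) (Set.Icc 0 x) := by
    have hder : ∀ y ∈ Set.Icc 0 x, HasDerivAt (fun y => W y * Real.exp (-(y / √(l - y ^ 2) ^ 3)))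
        (-((1 / √(l - y ^ 2) ^ 3 + 3 * y ^ 2 / √(l - y ^ 2) ^ 5)
          * Real.exp (-(y / √(l - y ^ 2) ^ 3)) * (f y * f' y + W y))) y := by
      intro y hy
      refine HasDerivAt.congr_deriv ((hW' y hy).fun_mul ((ha' y hy).fun_neg.exp)) ?_
      ring
    refine antitoneOn_of_hasDerivWithinAt_nonpos (convex_Icc 0 x)
      (fun y hy => (hder y hy).continuousAt.continuousWithinAt)
      (fun y hy => (hder y (interior_subset hy)).hasDerivWithinAt) ?_
    intro y hy
    have hy := interior_subset hy
    have hrp := hs.trans_le (hr y hy)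
    have h1 := (hWge y hy).2
    have h2 := neg_abs_le (f y * f' y)
    have h3 : 0 ≤ f y * f' y + W y := by linarith
    rw [neg_nonpos]
    positivity
  have hmem : x ∈ Set.Icc 0 x := ⟨hx0, le_rfl⟩
  have hmono := hanti ⟨le_rfl, hx0⟩ hmem hx0
  have hsq0 : √(l - 0 ^ 2) = s ^ 3 := by
    rw [hl, show s ^ 6 - 0 ^ 2 = (s ^ 3) ^ 2 by ring, Real.sqrt_sq (by positivity)]
  have hW0 : W 0 ≤ K := by
    simp only [hW, hsq0, zero_div, zero_mul, sub_zero]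
    exact h0
  have hrp := hs.trans_le (hr x hmem)
  have ha1 : x / √(l - x ^ 2) ^ 3 ≤ 1 := (div_le_one (by positivity)).2 (hxs x hmem)
  have hWx : W x ≤ Real.exp 1 * K := by
    have hWn : 0 ≤ W x := (abs_nonneg _).trans (hWge x hmem).2
    have h1 : W x * Real.exp (-1) ≤ K := by
      calc W x * Real.exp (-1) ≤ W x * Real.exp (-(x / √(l - x ^ 2) ^ 3)) := by gcongr
        _ ≤ W 0 := by simpa using hmono
        _ ≤ K := hW0
    calc W x = Real.exp 1 * (W x * Real.exp (-1)) := by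
          rw [mul_left_comm, ← Real.exp_add]; simp
      _ ≤ _ := by gcongr
  have := (hWge x hmem).1
  linarith

/-- Decaying solutions of `f'' = -(l - x²) f` with controlled initial data are `O(l^{-1/12})`
on the half-line. -/
lemma oscillator_sq_le {f f' : ℝ → ℝ} {l s x K : ℝ}
    (hf : ∀ x, HasDerivAt f (f' x) x) (hf' : ∀ x, HasDerivAt f' (-(l - x ^ 2) * f x) x)
    (hs : 1 ≤ s) (hl : l = s ^ 6)
    (h0 : s ^ 3 * f 0 ^ 2 + f' 0 ^ 2 / s ^ 3 ≤ K)
    (hlim : Tendsto (fun x => f x * f' x) atTop (nhds 0)) (hx : 0 ≤ x) :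
    f x ^ 2 ≤ 8 * Real.exp 1 * K / s := by
  have hs0 : 0 < s := by linarith
  have hK : 0 ≤ K := le_trans (by positivity) h0
  set x₀ := √(s ^ 6 - s ^ 2) with hx₀
  have hs62 : 0 ≤ s ^ 6 - s ^ 2 := sub_nonneg.2 (pow_le_pow_right₀ hs (by norm_num))
  have hx₀sq : x₀ ^ 2 = s ^ 6 - s ^ 2 := Real.sq_sqrt hs62
  have hx₀n : 0 ≤ x₀ := Real.sqrt_nonneg _
  have hx₀le : x₀ ≤ s ^ 3 := Real.sqrt_le_iff.2 ⟨by positivity, by nlinarith [sq_nonneg s]⟩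
  have hosc : ∀ y, 0 ≤ y → y ≤ x₀ → f y ^ 2 ≤ 2 * Real.exp 1 * K / s := by
    intro y hy0 hy
    have hy2 : y ^ 2 ≤ s ^ 6 - s ^ 2 := by
      rw [← hx₀sq]; exact pow_le_pow_left₀ hy0 hy 2
    have h := oscillator_energy_bound hf hf' hs0 hl h0 hy0 hy2
    have hr : s ≤ √(l - y ^ 2) := Real.le_sqrt_of_sq_le (by rw [hl]; linarith)
    have h1 : 0 ≤ f' y ^ 2 / √(l - y ^ 2) := by positivity
    have h2 : s * f y ^ 2 ≤ √(l - y ^ 2) * f y ^ 2 := by gcongr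
    rw [le_div_iff₀ hs0]
    linarith
  have henergy : AntitoneOn (fun y => (l - y ^ 2) * f y ^ 2 + f' y ^ 2) (Set.Ici 0) := by
    have hder : ∀ y, HasDerivAt (fun y => (l - y ^ 2) * f y ^ 2 + f' y ^ 2)
        (-(2 * y * f y ^ 2)) y := by
      intro y
      refine HasDerivAt.congr_deriv
        ((((hasDerivAt_pow 2 y).const_sub l).fun_mul ((hf y).fun_pow 2)).fun_add
        ((hf' y).fun_pow 2)) ?_
      simp
      ring
    refine antitoneOn_of_hasDerivWithinAt_nonpos (convex_Ici 0)
      (fun y _ => (hder y).continuousAt.continuousWithinAt)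
      (fun y _ => (hder y).hasDerivWithinAt) ?_
    intro y hy
    have hy : 0 ≤ y := interior_subset hy
    rw [neg_nonpos]
    positivity
  have hderiv : ∀ y, x₀ ≤ y → y ≤ s ^ 3 → f' y ^ 2 ≤ 2 * Real.exp 1 * K * s := by
    intro y hy hys
    have h1 := henergy (Set.mem_Ici.2 hx₀n) (Set.mem_Ici.2 (hx₀n.trans hy)) hy
    have h := oscillator_energy_bound hf hf' hs0 hl h0 hx₀n hx₀sq.le
    have hq : l - x₀ ^ 2 = s ^ 2 := by rw [hl, hx₀sq]; ring
    simp only [hq] at h1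
    rw [hq, Real.sqrt_sq hs0.le] at h
    have h2 : 0 ≤ (l - y ^ 2) * f y ^ 2 := by
      refine mul_nonneg ?_ (sq_nonneg _)
      have := pow_le_pow_left₀ (hx₀n.trans hy) hys 2
      rw [hl]; nlinarith
    have h3 : s ^ 2 * f x₀ ^ 2 + f' x₀ ^ 2 = (s * f x₀ ^ 2 + f' x₀ ^ 2 / s) * s := by
      field_simp
    have h4 := mul_le_mul_of_nonneg_right h hs0.le
    linarith
  have htrans : ∀ y, x₀ ≤ y → y ≤ s ^ 3 → f y ^ 2 ≤ 8 * Real.exp 1 * K / s := by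
    intro y hy hys
    have hlip : ‖f y - f x₀‖ ≤ √(2 * Real.exp 1 * K * s) * ‖y - x₀‖ := by
      refine (convex_Icc x₀ (s ^ 3)).norm_image_sub_le_of_norm_hasDerivWithin_le
        (fun z _ => (hf z).hasDerivWithinAt) ?_ ⟨le_rfl, hx₀le⟩ ⟨hy, hys⟩
      intro z hz
      exact Real.abs_le_sqrt (hderiv z hz.1 hz.2)
    have hgap : ‖y - x₀‖ ≤ 1 / s := by
      rw [Real.norm_eq_abs, abs_of_nonneg (by linarith), le_div_iff₀ hs0]
      have h1 : (s ^ 3 - x₀) * s ^ 3 ≤ s ^ 2 := by nlinarith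
      have h2 : (y - x₀) * s * s ^ 2 ≤ 1 * s ^ 2 := by
        have : (y - x₀) * s ^ 3 ≤ (s ^ 3 - x₀) * s ^ 3 := by gcongr
        nlinarith
      exact le_of_mul_le_mul_right h2 (by positivity)
    set M := 2 * Real.exp 1 * K with hM
    have hM0 : 0 ≤ M := by positivity
    have h1 : (f y - f x₀) ^ 2 ≤ M / s := by
      calc (f y - f x₀) ^ 2 = ‖f y - f x₀‖ ^ 2 := by simp
        _ ≤ (√(M * s) * (1 / s)) ^ 2 := by
          gcongr
          exact hlip.trans (by gcongr)
        _ = M / s := by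
          rw [mul_pow, Real.sq_sqrt (by positivity)]
          field_simp
    have h2 := hosc x₀ hx₀n le_rfl
    have h3 : f y ^ 2 ≤ 2 * (f y - f x₀) ^ 2 + 2 * f x₀ ^ 2 := by
      nlinarith [sq_nonneg (f y - 2 * f x₀)]
    have h4 : 8 * Real.exp 1 * K / s = 4 * (M / s) := by rw [hM]; ring
    linarith
  rcases le_total x x₀ with h | h
  · refine (hosc x hx h).trans ?_
    gcongr
    norm_num
  rcases le_total x (s ^ 3) with h' | h'
  · exact htrans x h h'
  refine le_trans ?_ (htrans (s ^ 3) hx₀le le_rfl)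
  have hmono : MonotoneOn (fun y => f y * f' y) (Set.Ici (s ^ 3)) := by
    have hder : ∀ y, HasDerivAt (fun y => f y * f' y) (f' y ^ 2 + (y ^ 2 - l) * f y ^ 2) y := by
      intro y
      refine HasDerivAt.congr_deriv ((hf y).fun_mul (hf' y)) ?_
      ring
    refine monotoneOn_of_hasDerivWithinAt_nonneg (convex_Ici _)
      (fun y _ => (hder y).continuousAt.continuousWithinAt)
      (fun y _ => (hder y).hasDerivWithinAt) ?_
    intro y hy
    have hy : s ^ 3 ≤ y := interior_subset hy
    have : l ≤ y ^ 2 := by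
      rw [hl, show s ^ 6 = (s ^ 3) ^ 2 by ring]
      exact pow_le_pow_left₀ (by positivity) hy 2
    have : 0 ≤ y ^ 2 - l := by linarith
    positivity
  have hnonpos : ∀ y, s ^ 3 ≤ y → f y * f' y ≤ 0 := by
    intro y hy
    refine ge_of_tendsto hlim ?_
    filter_upwards [eventually_ge_atTop y] with z hz
    exact hmono (Set.mem_Ici.2 hy) (Set.mem_Ici.2 (hy.trans hz)) hz
  have hanti : AntitoneOn (fun y => f y ^ 2) (Set.Ici (s ^ 3)) := by
    have hder : ∀ y, HasDerivAt (fun y => f y ^ 2) (2 * (f y * f' y)) y := by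
      intro y
      refine HasDerivAt.congr_deriv ((hf y).fun_pow 2) ?_
      simp
      ring
    refine antitoneOn_of_hasDerivWithinAt_nonpos (convex_Ici _)
      (fun y _ => (hder y).continuousAt.continuousWithinAt)
      (fun y _ => (hder y).hasDerivWithinAt) ?_
    intro y hy
    have := hnonpos y (interior_subset hy)
    linarith
  exact hanti (Set.mem_Ici.2 le_rfl) (Set.mem_Ici.2 h') h'

lemma hermiteFun_eq (k : ℕ) (t : ℝ) :
    hermiteFun k t = ((2 : ℝ) ^ k * (Nat.factorial k : ℝ) * √Real.pi) ^ (-(1 : ℝ) / 2) *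
      ((physHermite k).eval t * Real.exp (-(t ^ 2) / 2)) := by
  have h : hermitePolyFun k t = (physHermite k).eval t := by
    rw [hermitePolyFun, physHermite.iteratedDeriv_gaussian]
    have h1 : ((-1 : ℝ) ^ k) * (-1) ^ k = 1 := by rw [← mul_pow]; simp
    have h2 : Real.exp (t ^ 2) * Real.exp (-t ^ 2) = 1 := by rw [← Real.exp_add]; simp
    linear_combination (physHermite k).eval t * (Real.exp (t ^ 2) * Real.exp (-t ^ 2) * h1 + h2)
  rw [hermiteFun, h, mul_assoc]

lemma hermiteFun_neg (k : ℕ) (t : ℝ) : hermiteFun k (-t) = (-1) ^ k * hermiteFun k t := by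
  rw [hermiteFun_eq, hermiteFun_eq, physHermite.eval_neg, neg_sq]
  ring

open Polynomial in
lemma tendsto_polynomial_mul_exp_neg_sq (p : ℝ[X]) :
    Tendsto (fun x => p.eval x * Real.exp (-x ^ 2)) atTop (nhds 0) := by
  refine squeeze_zero_norm' ?_ (tendsto_zero_iff_norm_tendsto_zero.1 p.tendsto_div_exp_atTop)
  filter_upwards [eventually_ge_atTop 1] with x hx
  rw [div_eq_mul_inv, ← Real.exp_neg, norm_mul, norm_mul]
  gcongr
  simp only [Real.norm_eq_abs, Real.abs_exp, Real.exp_le_exp]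
  nlinarith

open Polynomial in
lemma hermiteFun_sq_le_of_nonneg (k : ℕ) {x : ℝ} (hx : 0 ≤ x) :
    hermiteFun k x ^ 2 ≤ 32 * Real.exp 1 / (2 * k + 1 : ℝ) ^ ((1 : ℝ) / 6) := by
  set c := ((2 : ℝ) ^ k * (Nat.factorial k : ℝ) * √Real.pi) ^ (-(1 : ℝ) / 2) with hc
  set p := physHermite k with hp
  set s := (2 * k + 1 : ℝ) ^ ((1 : ℝ) / 6) with hs
  have hs1 : 1 ≤ s := Real.one_le_rpow (by linarith [k.cast_nonneg (α := ℝ)]) (by norm_num)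
  have hs6 : (2 * k + 1 : ℝ) = s ^ 6 := by
    rw [hs, ← Real.rpow_natCast, ← Real.rpow_mul (by positivity)]
    norm_num
  have hgauss : ∀ y : ℝ, HasDerivAt (fun y : ℝ => Real.exp (-(y ^ 2) / 2))
      (-y * Real.exp (-(y ^ 2) / 2)) y := by
    intro y
    refine HasDerivAt.congr_deriv (((hasDerivAt_pow 2 y).fun_neg.div_const 2).exp) ?_
    simp
    ring
  have hf : ∀ y, HasDerivAt (hermiteFun k)
      (c * ((derivative p - X * p).eval y * Real.exp (-(y ^ 2) / 2))) y := by
    intro y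
    rw [funext (hermiteFun_eq k)]
    refine HasDerivAt.congr_deriv (((p.hasDerivAt y).fun_mul (hgauss y)).const_mul c) ?_
    simp only [eval_sub, eval_mul, eval_X]
    ring
  have hf' : ∀ y, HasDerivAt
      (fun y => c * ((derivative p - X * p).eval y * Real.exp (-(y ^ 2) / 2)))
      (-((2 * k + 1) - y ^ 2) * hermiteFun k y) y := by
    intro y
    rw [hermiteFun_eq]
    refine HasDerivAt.congr_deriv
      ((((derivative p - X * p).hasDerivAt y).fun_mul (hgauss y)).const_mul c) ?_
    simp only [derivative_sub, derivative_mul, derivative_X, hp,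
      physHermite.derivative_derivative k]
    simp
    ring
  have hlim : Tendsto (fun y => hermiteFun k y *
      (c * ((derivative p - X * p).eval y * Real.exp (-(y ^ 2) / 2)))) atTop (nhds 0) := by
    have h := (tendsto_polynomial_mul_exp_neg_sq (p * (derivative p - X * p))).const_mul (c ^ 2)
    rw [mul_zero] at h
    refine h.congr fun y => ?_
    have he : Real.exp (-y ^ 2) = Real.exp (-(y ^ 2) / 2) * Real.exp (-(y ^ 2) / 2) := by
      rw [← Real.exp_add, add_halves]
    rw [hermiteFun_eq, ← hc, ← hp, eval_mul, he]
    ring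
  have hpi : 1 ≤ √Real.pi := by
    rw [Real.one_le_sqrt]
    linarith [Real.pi_gt_three]
  have hc2 : c ^ 2 ≤ 1 / (2 ^ k * (k.factorial : ℝ)) := by
    rw [hc, ← Real.rpow_natCast, ← Real.rpow_mul (by positivity)]
    rw [show (-(1 : ℝ) / 2) * ((2 : ℕ) : ℝ) = -1 by norm_num, Real.rpow_neg_one, mul_inv, one_div]
    exact mul_le_of_le_one_right (by positivity) (inv_le_one_of_one_le₀ hpi)
  have h0 : s ^ 3 * hermiteFun k 0 ^ 2
      + (c * ((derivative p - X * p).eval 0 * Real.exp (-(0 ^ 2) / 2))) ^ 2 / s ^ 3 ≤ 4 := by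
    have hk : (0 : ℝ) ≤ k := k.cast_nonneg
    have hb0 := physHermite.eval_zero_sq_le k
    have hb1 := physHermite.eval_zero_sq_le (k + 1)
    have hder : (derivative p).eval 0 = -(physHermite (k + 1)).eval 0 := by
      simp [physHermite, hp]
    have hA : s ^ 3 * hermiteFun k 0 ^ 2 ≤ 2 := by
      have h1 : hermiteFun k 0 ^ 2 ≤ p.eval 0 ^ 2 / (2 ^ k * (k.factorial : ℝ)) := by
        rw [hermiteFun_eq, mul_pow]
        calc c ^ 2 * (p.eval 0 * Real.exp (-(0 ^ 2) / 2)) ^ 2 = c ^ 2 * p.eval 0 ^ 2 := by simp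
          _ ≤ 1 / (2 ^ k * (k.factorial : ℝ)) * p.eval 0 ^ 2 := by gcongr
          _ = _ := by ring
      set b := p.eval 0 ^ 2 / (2 ^ k * (k.factorial : ℝ)) with hb
      have hbn : 0 ≤ b := by positivity
      refine (mul_le_mul_of_nonneg_left h1 (by positivity)).trans ?_
      refine le_of_sq_le_sq ?_ (by norm_num)
      rw [mul_pow, ← pow_mul, show 3 * 2 = 6 from rfl, ← hs6]
      nlinarith [sq_nonneg b]
    have hB : (c * ((derivative p - X * p).eval 0 * Real.exp (-(0 ^ 2) / 2))) ^ 2 / s ^ 3 ≤ 2 := by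
      have h1 : (c * ((derivative p - X * p).eval 0 * Real.exp (-(0 ^ 2) / 2))) ^ 2
          ≤ 2 * (k + 1) * ((physHermite (k + 1)).eval 0 ^ 2
            / (2 ^ (k + 1) * ((k + 1).factorial : ℝ))) := by
        calc _ = c ^ 2 * (physHermite (k + 1)).eval 0 ^ 2 := by simp [hder, mul_pow]
          _ ≤ 1 / (2 ^ k * (k.factorial : ℝ)) * (physHermite (k + 1)).eval 0 ^ 2 := by gcongr
          _ = _ := by
            rw [Nat.factorial_succ]
            have : (k.factorial : ℝ) ≠ 0 := by positivity
            push_cast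
            field_simp
            ring
      set b := (physHermite (k + 1)).eval 0 ^ 2 / (2 ^ (k + 1) * ((k + 1).factorial : ℝ)) with hb
      have hbn : 0 ≤ b := by positivity
      rw [div_le_iff₀ (by positivity)]
      refine h1.trans ?_
      refine le_of_sq_le_sq ?_ (by positivity)
      have e1 : (2 * s ^ 3) ^ 2 = 4 * (2 * k + 1) := by rw [hs6]; ring
      rw [e1]
      push_cast at hb1
      have h2 : (2 * ((k : ℝ) + 1) * b) ^ 2 ≤ 4 * (k + 1) * (b ^ 2 * (k + 1 + 1)) := by
        nlinarith [mul_nonneg hk (sq_nonneg b), sq_nonneg b]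
      nlinarith
    linarith
  have := oscillator_sq_le hf hf' hs1 hs6 h0 hlim hx
  convert this using 1
  ring

lemma abs_hermiteFun_le (k : ℕ) (x : ℝ) :
    |hermiteFun k x| ≤ √(32 * Real.exp 1) * (2 * k + 1 : ℝ) ^ (-(1 : ℝ) / 12) := by
  have habs : |hermiteFun k x| = |hermiteFun k (abs x)| := by
    rcases abs_choice x with h | h <;> rw [h]
    rw [hermiteFun_neg, abs_mul, abs_pow]
    simp
  rw [habs]
  refine abs_le_of_sq_le_sq ?_ (by positivity)
  refine (hermiteFun_sq_le_of_nonneg k (abs_nonneg x)).trans_eq ?_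
  rw [mul_pow, Real.sq_sqrt (by positivity), div_eq_mul_inv, ← Real.rpow_neg (by positivity),
    ← Real.rpow_natCast, ← Real.rpow_mul (by positivity)]
  norm_num

theorem stmt4 (n : ℕ) (hn : 1 ≤ n) :
    ∃ C > (0 : ℝ), ∀ ν : Fin n → ℕ, ν ≠ 0 →
      eLpNorm (hermiteFunPi ν) ⊤ volume ≤
        ENNReal.ofReal (C * (((∑ j, ν j : ℕ) : ℝ)) ^ (-(1 : ℝ) / 12)) := by
  refine ⟨√(32 * Real.exp 1) ^ n, by positivity, fun ν hν => ?_⟩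
  rw [eLpNorm_exponent_top]
  refine eLpNormEssSup_le_of_ae_bound (Eventually.of_forall fun x => ?_)
  have hsum : 0 < ∑ j, ν j := by
    obtain ⟨j, hj⟩ := Function.ne_iff.1 hν
    exact Finset.sum_pos' (fun _ _ => Nat.zero_le _) ⟨j, Finset.mem_univ j, Nat.pos_of_ne_zero hj⟩
  have hprod : ((∑ j, ν j : ℕ) : ℝ) ≤ ∏ j, (2 * ν j + 1 : ℝ) := by
    have h : ∑ j, ν j ≤ ∏ j, (2 * ν j + 1) := by
      refine le_trans (Nat.le_succ _) ?_
      induction (Finset.univ : Finset (Fin n)) using Finset.cons_induction with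
      | empty => simp
      | cons a t ha ih =>
        rw [Finset.sum_cons, Finset.prod_cons]
        have h := Nat.mul_le_mul_left (2 * ν a) ((Nat.le_add_left 1 _).trans ih)
        rw [Nat.succ_eq_add_one] at ih ⊢
        linarith
    exact_mod_cast h
  calc ‖hermiteFunPi ν x‖ = ∏ j, |hermiteFun (ν j) (x j)| := by
        rw [hermiteFunPi, Real.norm_eq_abs, Finset.abs_prod]
    _ ≤ ∏ j, (√(32 * Real.exp 1) * (2 * ν j + 1 : ℝ) ^ (-(1 : ℝ) / 12)) :=
        Finset.prod_le_prod (fun _ _ => abs_nonneg _) fun j _ => abs_hermiteFun_le _ _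
    _ = √(32 * Real.exp 1) ^ n * (∏ j, (2 * ν j + 1 : ℝ)) ^ (-(1 : ℝ) / 12) := by
        rw [Finset.prod_mul_distrib, Real.finsetProd_rpow _ _ fun _ _ => by positivity]
        simp
    _ ≤ _ := by
        gcongr ?_ * ?_
        exact Real.rpow_le_rpow_of_nonpos (by exact_mod_cast hsum) hprod (by norm_num)
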